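/- Let n ≥ 3 and let λ be a nonzero nilpotent Jordan multiplication on ℂⁿ that is not isomorphic to λ₂⊕𝔞ₙ₋₂. Then J₃ lies in closure(Orb(λ)). -/

import Mathlib

noncomputable section

abbrev V (n : ℕ) : Type := Fin n → ℂ

abbrev Bil (n : ℕ) : Type := V n →ₗ[ℂ] V n →ₗ[ℂ] V n

instance BilTop (n : ℕ) : TopologicalSpace (Bil n) :=
  TopologicalSpace.induced (fun μ : Bil n => fun x y : V n => μ x y) inferInstance

/-- The change-of-basis action of a linear automorphism on multiplications. -/
def act {n : ℕ} (g : V n ≃ₗ[ℂ] V n) (μ : Bil n) : Bil n :=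
  LinearMap.mk₂ ℂ (fun x y => g (μ (g.symm x) (g.symm y)))
    (fun x x' y => by simp)
    (fun c x y => by simp)
    (fun x y y' => by simp)
    (fun c x y => by simp)

/-- The orbit of a multiplication under the change-of-basis action. -/
def orb {n : ℕ} (μ : Bil n) : Set (Bil n) :=
  Set.range fun g : V n ≃ₗ[ℂ] V n => act g μ

/-- Two multiplications are isomorphic iff they lie in the same orbit. -/
def Isom {n : ℕ} (μ ν : Bil n) : Prop := ∃ g : V n ≃ₗ[ℂ] V n, act g μ = ν

def levelOne {n : ℕ} (lam : Bil n) : Prop :=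
  lam ≠ 0 ∧ closure (orb lam) ⊆ orb lam ∪ {0}

def levelTwo {n : ℕ} (lam : Bil n) : Prop :=
  (∀ μ ∈ closure (orb lam) \ orb lam, closure (orb μ) ⊆ orb μ ∪ {0}) ∧
  ∃ μ ∈ closure (orb lam) \ orb lam, μ ≠ 0

/-- `E n k` is the standard basis vector `e_{k+1}` of `ℂⁿ` (0-indexed `k`). -/
def E (n k : ℕ) : V n := fun m => if (m : ℕ) = k then 1 else 0

/-- The bilinear multiplication determined by a table of products of basis vectors. -/
def ofTable {n : ℕ} (c : Fin n → Fin n → V n) : Bil n :=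
  LinearMap.mk₂ ℂ (fun x y => ∑ i : Fin n, ∑ j : Fin n, (x i * y j) • c i j)
    (fun x x' y => by
      simp [add_mul, add_smul, Finset.sum_add_distrib])
    (fun a x y => by
      simp [Finset.smul_sum, smul_smul, mul_assoc])
    (fun x y y' => by
      simp [mul_add, add_smul, Finset.sum_add_distrib])
    (fun a x y => by
      simp [Finset.smul_sum, smul_smul, mul_assoc, mul_left_comm])

def JordanMul {n : ℕ} (lam : Bil n) : Prop :=
  (∀ x y : V n, lam x y = lam y x) ∧
  ∀ x y : V n, lam (lam x x) (lam y x) = lam (lam (lam x x) y) x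

def LieMul {n : ℕ} (lam : Bil n) : Prop :=
  (∀ x : V n, lam x x = 0) ∧
  ∀ x y z : V n, lam x (lam y z) + lam y (lam z x) + lam z (lam x y) = 0

def AssocMul {n : ℕ} (lam : Bil n) : Prop :=
  ∀ x y z : V n, lam (lam x y) z = lam x (lam y z)
/-- `J₁`: `e₁·e₁ = e₁`. -/
def J1 (n : ℕ) : Bil n :=
  ofTable fun i j => if i.val = 0 ∧ j.val = 0 then E n 0 else 0

/-- `J₂`: `e₁·e₁ = e₁`, `e₁·eᵢ = eᵢ·e₁ = eᵢ` for `2 ≤ i ≤ n`. -/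
def J2 (n : ℕ) : Bil n :=
  ofTable fun i j =>
    if i.val = 0 then E n j.val else if j.val = 0 then E n i.val else 0

/-- `J₃`: `e₁·e₂ = e₂·e₁ = e₃`. -/
def J3 (n : ℕ) : Bil n :=
  ofTable fun i j =>
    if (i.val = 0 ∧ j.val = 1) ∨ (i.val = 1 ∧ j.val = 0) then E n 2 else 0

/-- `λ₂ ⊕ 𝔞_{n-2}`: `e₁e₁ = e₂`. -/
def lam2a (n : ℕ) : Bil n :=
  ofTable fun i j => if i.val = 0 ∧ j.val = 0 then E n 1 else 0

/-- The powers `J^k` of a multiplication: `J¹ = ℂⁿ`,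
`J^(k+1) = span {λ x y : x ∈ J^i, y ∈ J^j, i + j = k + 1}`. -/
def Jpow {n : ℕ} (lam : Bil n) : ℕ → Submodule ℂ (V n)
  | 0 => ⊤
  | 1 => ⊤
  | (k+2) =>
      ⨆ (p : ℕ × ℕ) (_ : 0 < p.1) (_ : 0 < p.2) (_ : p.1 + p.2 = k + 2),
        Submodule.span ℂ {z : V n | ∃ x ∈ Jpow lam p.1, ∃ y ∈ Jpow lam p.2, lam x y = z}
  termination_by k => k
  decreasing_by all_goals omega

theorem exists_frame {n k : ℕ} (v : Fin k → V n) (hv : LinearIndependent ℂ v) :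
    ∃ g : V n ≃ₗ[ℂ] V n, ∀ i : Fin k, g (v i) = E n i := by
  classical
  let B := Module.Basis.extend hv.linearIndepOn_id
  let S := hv.linearIndepOn_id.extend (Set.subset_univ (Set.range v))
  have hBS : ∀ i : S, B i = i := fun i => Module.Basis.extend_apply_self _ i
  haveI : Fintype S := Module.Basis.fintypeIndexOfRankLtAleph0 B (Module.rank_lt_aleph0 ℂ (V n))
  have hcard : Fintype.card S = n := by
    rw [← Module.finrank_eq_card_basis B]; simp
  have hkn : k ≤ n := by
    have := hv.fintype_card_le_finrank
    simpa using this
  have hcard' : Fintype.card (Fin n) = S.toFinset.card := by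
    rw [Set.toFinset_card, hcard, Fintype.card_fin]
  let f : Fin n → V n := fun i => if h : (i : ℕ) < k then v ⟨i, h⟩ else 0
  have hf1 : Set.MapsTo f {i : Fin n | (i : ℕ) < k} (S.toFinset : Set (V n)) := by
    intro i hi
    have hi' : (i : ℕ) < k := hi
    simp only [f, hi', dif_pos, Set.coe_toFinset]
    exact hv.linearIndepOn_id.subset_extend _ ⟨_, rfl⟩
  have hf2 : Set.InjOn f {i : Fin n | (i : ℕ) < k} := by
    intro i hi j hj hij
    have hi' : (i : ℕ) < k := hi
    have hj' : (j : ℕ) < k := hj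
    simp only [f, hi', hj', dif_pos] at hij
    have := hv.injective hij
    simp only [Fin.mk.injEq] at this
    exact Fin.ext this
  obtain ⟨e, he⟩ := hf1.exists_equiv_extend_of_card_eq hcard' hf2
  let e' : Fin n ≃ S := e.trans (Equiv.subtypeEquivRight (by intro x; exact Set.mem_toFinset))
  let C := B.reindex e'.symm
  refine ⟨C.equivFun, fun i => ?_⟩
  let i' : Fin n := ⟨i, lt_of_lt_of_le i.2 hkn⟩
  have h1 : C i' = v i := by
    have := he i' (by simp [i'])
    simp only [C, Module.Basis.reindex_apply, Equiv.symm_symm, hBS]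
    have h2 : ((e' i' : S) : V n) = e i' := rfl
    rw [h2, this]
    simp [f, i']
  rw [← h1]
  ext m
  rw [Module.Basis.equivFun_self]
  simp only [E, i', Fin.ext_iff, eq_comm]

theorem exists_frame_dual {n k : ℕ} (v : Fin k → V n) (hv : LinearIndependent ℂ v)
    (r : Fin k) (φ : V n →ₗ[ℂ] ℂ) (hφ : ∀ i, φ (v i) = if i = r then 1 else 0) (hr : (r : ℕ) < n) :
    ∃ g : V n ≃ₗ[ℂ] V n, (∀ i : Fin k, g (v i) = E n i) ∧ ∀ u, g u ⟨r, hr⟩ = φ u := by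
  obtain ⟨g, hg⟩ := exists_frame v hv
  let p : V n →ₗ[ℂ] ℂ := LinearMap.proj ⟨r, hr⟩
  let G : V n →ₗ[ℂ] V n := (g : V n →ₗ[ℂ] V n) +
    (φ - p ∘ₗ (g : V n →ₗ[ℂ] V n)).smulRight (E n r)
  have hG : ∀ u, G u = g u + (φ u - g u ⟨r, hr⟩) • E n r := fun u => rfl
  have hGr : ∀ u, G u ⟨r, hr⟩ = φ u := by
    intro u; rw [hG]; simp [E]
  have hinj : Function.Injective G := by
    rw [injective_iff_map_eq_zero]
    intro u hu
    have h1 : φ u = 0 := by rw [← hGr, hu]; rfl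
    rw [hG, h1] at hu
    have h2 : g u = g (g u ⟨r, hr⟩ • v r) := by
      rw [map_smul, hg]
      have := eq_neg_of_add_eq_zero_left hu
      rw [this]; simp [E]
    have h3 := g.injective h2
    have h4 : g u ⟨r, hr⟩ = 0 := by
      have := congrArg φ h3
      rw [h1, map_smul, hφ] at this
      simpa using this.symm
    rw [h3, h4, zero_smul]
  refine ⟨LinearEquiv.ofInjectiveEndo G hinj, fun i => ?_, fun u => ?_⟩
  · rw [LinearEquiv.coe_ofInjectiveEndo, hG, hg, hφ]
    have : E n i ⟨r, hr⟩ = if i = r then 1 else 0 := by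
      simp [E, Fin.ext_iff, eq_comm]
    rw [this]; simp
  · rw [LinearEquiv.coe_ofInjectiveEndo, hGr]

theorem E_eq_single {n : ℕ} (i : Fin n) : E n i = Pi.single i 1 := by
  ext m; simp [E, Pi.single_apply, Fin.ext_iff]

theorem act_apply {n : ℕ} (g : V n ≃ₗ[ℂ] V n) (μ : Bil n) (x y : V n) :
    act g μ x y = g (μ (g.symm x) (g.symm y)) := rfl

theorem bil_expand {n : ℕ} (μ : Bil n) (x y : V n) (k : Fin n) :
    μ x y k = ∑ i, ∑ j, x i * y j * μ (E n i) (E n j) k := by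
  have hx : ∀ x : V n, x = ∑ i, x i • E n i := by
    intro x
    simp_rw [E_eq_single]
    exact pi_eq_sum_univ' x
  conv_lhs => rw [hx x, hx y]
  simp only [map_sum, LinearMap.sum_apply, map_smul, LinearMap.smul_apply, Finset.sum_apply,
    Pi.smul_apply, smul_eq_mul, Finset.mul_sum]
  rw [Finset.sum_comm]
  refine Finset.sum_congr rfl fun i _ => Finset.sum_congr rfl fun j _ => ?_
  ring

def wt (k : ℕ) : ℕ := if k = 0 ∨ k = 1 then 2 else if k = 2 then 4 else 3

theorem wt_le (i j k : ℕ) : wt k ≤ wt i + wt j := by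
  unfold wt; split_ifs <;> omega

theorem degen {n : ℕ} (hn : 3 ≤ n) (μ : Bil n)
    (h00 : μ (E n 0) (E n 0) ⟨2, hn⟩ = 0) (h11 : μ (E n 1) (E n 1) ⟨2, hn⟩ = 0)
    (h01 : μ (E n 0) (E n 1) ⟨2, hn⟩ = 1) (h10 : μ (E n 1) (E n 0) ⟨2, hn⟩ = 1) :
    J3 n ∈ closure (orb μ) := by
  let F : ℂ → Bil n := fun t => ofTable fun i j => fun k =>
    t ^ (wt i + wt j - wt k) * μ (E n i) (E n j) k
  have hF : Continuous F := by
    rw [continuous_induced_rng]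
    refine continuous_pi fun x => continuous_pi fun y => continuous_pi fun k => ?_
    simp only [Function.comp_def, F, ofTable, LinearMap.mk₂_apply, Finset.sum_apply, Pi.smul_apply]
    fun_prop
  have h0 : F 0 = J3 n := by
    simp only [F, J3]
    congr 1
    funext i j k
    obtain ⟨i, hi⟩ := i
    obtain ⟨j, hj⟩ := j
    obtain ⟨k, hk⟩ := k
    simp only
    by_cases hz : (i = 0 ∨ i = 1) ∧ (j = 0 ∨ j = 1) ∧ k = 2
    · obtain ⟨h1, h2, rfl⟩ := hz
      rcases h1 with rfl | rfl <;> rcases h2 with rfl | rfl <;> simp [wt, E, h00, h01, h10, h11]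
    · have : wt i + wt j - wt k ≠ 0 := by
        unfold wt; split_ifs <;> omega
      rw [zero_pow this, zero_mul]
      split_ifs with h
      · have : k ≠ 2 := by omega
        simp [E, this]
      · rfl
  have hmem : ∀ t : ℂ, t ≠ 0 → F t ∈ orb μ := by
    intro t ht
    let g : V n ≃ₗ[ℂ] V n := LinearEquiv.piCongrRight fun i : Fin n =>
      LinearEquiv.smulOfNeZero ℂ ℂ ((t ^ wt i)⁻¹) (inv_ne_zero (pow_ne_zero _ ht))
    have hg : ∀ x i, g x i = (t ^ wt i)⁻¹ * x i := fun x i => rfl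
    have hgs : ∀ x i, g.symm x i = t ^ wt i * x i := by
      intro x i
      have h := hg (g.symm x) i
      rw [LinearEquiv.apply_symm_apply] at h
      rw [h, mul_inv_cancel_left₀ (pow_ne_zero _ ht)]
    refine ⟨g, ?_⟩
    refine LinearMap.ext fun x => ?_
    refine LinearMap.ext fun y => ?_
    funext k
    change act g μ x y k = _
    rw [act_apply, hg, bil_expand]
    simp only [F, ofTable, LinearMap.mk₂_apply, Finset.sum_apply, Pi.smul_apply, smul_eq_mul,
      Finset.mul_sum, hgs]
    refine Finset.sum_congr rfl fun i _ => Finset.sum_congr rfl fun j _ => ?_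
    rw [pow_sub₀ t ht (wt_le i j k), pow_add]
    ring
  rw [← h0]
  have h1 : (0 : ℂ) ∈ closure ({0}ᶜ : Set ℂ) := by
    rw [dense_compl_singleton (0 : ℂ) |>.closure_eq]; trivial
  refine closure_mono ?_ (image_closure_subset_closure_image hF ⟨0, h1, rfl⟩)
  rintro _ ⟨t, ht, rfl⟩
  exact hmem t ht

theorem orb_act {n : ℕ} (g : V n ≃ₗ[ℂ] V n) (μ : Bil n) : orb (act g μ) ⊆ orb μ := by
  rintro _ ⟨h, rfl⟩
  exact ⟨g.trans h, rfl⟩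

theorem degen_iso {n : ℕ} (hn : 3 ≤ n) (lam : Bil n) (hc : ∀ x y, lam x y = lam y x)
    (φ : V n →ₗ[ℂ] ℂ) (x y : V n) (hx : φ x = 0) (hy : φ y = 0)
    (hxx : φ (lam x x) = 0) (hyy : φ (lam y y) = 0) (hxy : φ (lam x y) = 1) :
    J3 n ∈ closure (orb lam) := by
  have hyx : φ (lam y x) = 1 := by rw [hc, hxy]
  have hli : LinearIndependent ℂ ![x, y, lam x y] := by
    rw [Fintype.linearIndependent_iff]
    intro c hcs
    simp only [Fin.sum_univ_three, Matrix.cons_val] at hcs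
    have h2 : c 2 = 0 := by
      have := congrArg φ hcs
      simpa [hx, hy, hxy] using this
    rw [h2, zero_smul, add_zero] at hcs
    have h0 : c 0 = 0 := by
      have := congrArg (fun z => φ (lam z y)) hcs
      simpa [hxy, hyy] using this
    have h1 : c 1 = 0 := by
      have := congrArg (fun z => φ (lam z x)) hcs
      simpa [hyx, hxx] using this
    intro i; fin_cases i <;> assumption
  obtain ⟨g, hg, hgφ⟩ := exists_frame_dual _ hli 2 φ
    (by intro i; fin_cases i <;> simp [hx, hy, hxy]) hn
  have g0 : g.symm (E n 0) = x := by
    rw [LinearEquiv.symm_apply_eq]; exact (hg 0).symm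
  have g1 : g.symm (E n 1) = y := by
    rw [LinearEquiv.symm_apply_eq]; exact (hg 1).symm
  have hgφ' : ∀ u, g u ⟨2, hn⟩ = φ u := hgφ
  refine closure_mono (orb_act g lam) (degen hn _ ?_ ?_ ?_ ?_) <;>
    simp only [act_apply, g0, g1, hgφ', hxx, hyy, hxy, hyx]

theorem degen_half {n : ℕ} (hn : 3 ≤ n) (lam : Bil n) (hc : ∀ x y, lam x y = lam y x)
    (φ : V n →ₗ[ℂ] ℂ) (x p : V n) (hx : φ x = 0) (hp : φ p = 0)
    (hpp : φ (lam p p) = 0) (hxp : φ (lam x p) ≠ 0) :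
    J3 n ∈ closure (orb lam) := by
  have hpx : φ (lam p x) = φ (lam x p) := by rw [hc]
  set b := φ (lam x p) with hb
  set a := φ (lam x x) with ha
  refine degen_iso hn lam hc φ (b⁻¹ • x - (a / (2 * b ^ 2)) • p) p ?_ hp ?_ hpp ?_
  · simp [hx, hp]
  · simp [hpp, hpx, ← ha, ← hb]
    field_simp
    ring
  · simp [hpp, ← hb, hxp]

theorem degen_det {n : ℕ} (hn : 3 ≤ n) (lam : Bil n) (hc : ∀ x y, lam x y = lam y x)
    (φ : V n →ₗ[ℂ] ℂ) (x y : V n) (hx : φ x = 0) (hy : φ y = 0)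
    (hd : φ (lam x x) * φ (lam y y) ≠ φ (lam x y) ^ 2) :
    J3 n ∈ closure (orb lam) := by
  by_cases ha : φ (lam x x) = 0
  · refine degen_half hn lam hc φ y x hy hx ha ?_
    rw [hc y x]
    intro h
    apply hd
    rw [ha, h]; ring
  · obtain ⟨s, hs⟩ := exists_quadratic_eq_zero (a := φ (lam x x)) (b := 2 * φ (lam x y))
      (c := φ (lam y y)) ha (by
        obtain ⟨z, hz⟩ := IsAlgClosed.exists_pow_nat_eq
          (discrim (φ (lam x x)) (2 * φ (lam x y)) (φ (lam y y))) (n := 2) (by norm_num)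
        exact ⟨z, by rw [← hz]; ring⟩)
    have hyx : φ (lam y x) = φ (lam x y) := by rw [hc]
    refine degen_half hn lam hc φ x (s • x + y) hx (by simp [hx, hy]) ?_ ?_
    · simp [hyx]
      linear_combination hs
    · simp only [map_add, map_smul, smul_eq_mul]
      intro h
      apply hd
      linear_combination (φ (lam x x)) * hs -
        (s * φ (lam x x) + φ (lam x y)) * h

theorem nil_iter {n : ℕ} (lam : Bil n) (hnil : ∃ m : ℕ, Jpow lam m = ⊥) :
    ∃ k : ℕ, (fun S => Submodule.map₂ lam ⊤ S)^[k] ⊤ = ⊥ := by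
  have key : ∀ k, (fun S => Submodule.map₂ lam ⊤ S)^[k] ⊤ ≤ Jpow lam (k + 1) := by
    intro k
    induction k with
    | zero => rw [Jpow]; exact le_top
    | succ k ih =>
      rw [Function.iterate_succ_apply', Jpow]
      refine le_iSup_of_le (1, k + 1) (le_iSup_of_le (by simp) (le_iSup_of_le (by simp)
        (le_iSup_of_le (by simp; omega) ?_)))
      rw [Submodule.map₂_le]
      intro x _ y hy
      refine Submodule.subset_span ⟨x, ?_, y, ih hy, rfl⟩
      rw [Jpow]; trivial
  obtain ⟨m, hm⟩ := hnil
  cases m with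
  | zero => exact ⟨0, by rw [Jpow] at hm; exact hm⟩
  | succ k => exact ⟨k, le_bot_iff.1 (hm ▸ key k)⟩

theorem nil_stab {n : ℕ} (lam : Bil n) (hnil : ∃ m : ℕ, Jpow lam m = ⊥)
    (S : Submodule ℂ (V n)) (hS : S ≤ Submodule.map₂ lam ⊤ S) : S = ⊥ := by
  obtain ⟨k, hk⟩ := nil_iter lam hnil
  have : ∀ k, S ≤ (fun S => Submodule.map₂ lam ⊤ S)^[k] ⊤ := by
    intro k
    induction k with
    | zero => exact le_top
    | succ k ih =>
      rw [Function.iterate_succ_apply']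
      exact hS.trans (Submodule.map₂_le_map₂_right ih)
  exact le_bot_iff.1 (hk ▸ this k)

theorem case_cube {n : ℕ} (hn : 3 ≤ n) (lam : Bil n)
    (hJ : JordanMul lam) (hnil : ∃ m : ℕ, Jpow lam m = ⊥) (hne : lam ≠ 0)
    (h3 : Submodule.map₂ lam ⊤ (Submodule.map₂ lam ⊤ ⊤) ≠ ⊥) :
    J3 n ∈ closure (orb lam) := by
  obtain ⟨hc, hj⟩ := hJ
  set K2 := Submodule.map₂ lam ⊤ ⊤ with hK2
  set K3 := Submodule.map₂ lam ⊤ K2 with hK3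
  set K4 := Submodule.map₂ lam ⊤ K3 with hK4
  have m2 : ∀ x y, lam x y ∈ K2 := fun x y => Submodule.apply_mem_map₂ _ trivial trivial
  have m3 : ∀ x y, y ∈ K2 → lam x y ∈ K3 := fun x y h => Submodule.apply_mem_map₂ _ trivial h
  have m4 : ∀ x y, y ∈ K3 → lam x y ∈ K4 := fun x y h => Submodule.apply_mem_map₂ _ trivial h
  have l32 : K3 ≤ K2 := Submodule.map₂_le_map₂_right le_top
  have l43 : K4 ≤ K3 := Submodule.map₂_le_map₂_right l32
  have h34 : ¬ K3 ≤ K4 := fun h => h3 (nil_stab lam hnil K3 h)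
  obtain ⟨w, hw⟩ : ∃ w, w ∉ K2 := by
    by_contra! hcon
    have : (⊤ : Submodule ℂ (V n)) = ⊥ := nil_stab lam hnil ⊤ (fun w _ => hcon w)
    apply hne
    refine LinearMap.ext fun x => ?_
    have hx : x ∈ (⊤ : Submodule ℂ (V n)) := trivial
    rw [this, Submodule.mem_bot] at hx
    rw [hx, map_zero, map_zero]
  obtain ⟨a, x, hax⟩ : ∃ a x, lam x (lam a a) ∉ K4 := by
    by_contra! hcon
    apply h34
    rw [hK3, Submodule.map₂_le]
    intro x _ q hq
    have : K2 ≤ K4.comap (lam x) := by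
      rw [hK2, Submodule.map₂_le]
      intro a _ b _
      rw [Submodule.mem_comap]
      have h1 := hcon (a + b) x
      have h2 : lam x (lam a b) = (2⁻¹ : ℂ) • (lam x (lam (a + b) (a + b)) - lam x (lam a a)
          - lam x (lam b b)) := by
        simp only [map_add, LinearMap.add_apply, hc b a]
        module
      rw [h2]
      exact K4.smul_mem _ (K4.sub_mem (K4.sub_mem h1 (hcon _ _)) (hcon _ _))
    exact this hq
  set p := lam a a with hp
  obtain ⟨x, hx2, hxp⟩ : ∃ x, x ∉ K2 ∧ lam x p ∉ K4 := by
    by_cases hx : x ∈ K2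
    · by_cases hwp : lam w p ∈ K4
      · refine ⟨x + w, fun h => hw ((Submodule.add_mem_iff_right _ hx).1 h), fun h => hax ?_⟩
        rw [map_add, LinearMap.add_apply] at h
        exact (Submodule.add_mem_iff_left _ hwp).1 h
      · exact ⟨w, hw, hwp⟩
    · exact ⟨x, hx, hax⟩
  have hpp : lam p p ∈ K4 := by
    have := hj a a
    rw [← hp] at this
    rw [this, hc, hc p a]
    exact m4 _ _ (m3 _ _ (m2 _ _))
  have hp2 : p ∈ K2 := m2 _ _
  have hnot : lam x p ∉ Submodule.span ℂ {x, p} ⊔ K4 := by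
    intro h
    obtain ⟨u, hu, k, hk, huk⟩ := Submodule.mem_sup.1 h
    obtain ⟨α, β, rfl⟩ := Submodule.mem_span_pair.1 hu
    have hα : α = 0 := by
      by_contra hα
      apply hx2
      have : x = α⁻¹ • (lam x p - k - β • p) := by
        rw [← huk, add_sub_cancel_right, add_sub_cancel_right, smul_smul, inv_mul_cancel₀ hα,
          one_smul]
      rw [this]
      exact K2.smul_mem _ (K2.sub_mem (K2.sub_mem (m2 _ _) (l32 (l43 hk))) (K2.smul_mem _ hp2))
    rw [hα, zero_smul, zero_add] at huk
    have hβ : β = 0 := by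
      by_contra hβ
      apply hxp
      apply m4
      have : p = β⁻¹ • (lam x p - k) := by
        rw [← huk, add_sub_cancel_right, smul_smul, inv_mul_cancel₀ hβ, one_smul]
      rw [this]
      exact K3.smul_mem _ (K3.sub_mem (m3 _ _ hp2) (l43 hk))
    rw [hβ, zero_smul, zero_add] at huk
    exact hxp (huk ▸ hk)
  obtain ⟨φ, hφ, hker⟩ := Submodule.exists_le_ker_of_notMem hnot
  refine degen_half hn lam hc φ x p ?_ ?_ ?_ hφ
  · exact hker (Submodule.mem_sup_left (Submodule.subset_span (by simp)))
  · exact hker (Submodule.mem_sup_left (Submodule.subset_span (by simp)))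
  · exact hker (Submodule.mem_sup_right hpp)

theorem case_sq {n : ℕ} (hn : 3 ≤ n) (lam : Bil n) (hc : ∀ x y, lam x y = lam y x) (hne : lam ≠ 0)
    (h3 : ∀ x y z, lam x (lam y z) = 0) (hniso : ¬ Isom lam (lam2a n)) :
    J3 n ∈ closure (orb lam) := by
  by_contra hcon
  have h3' : ∀ x y z, lam (lam y z) x = 0 := fun x y z => by rw [hc, h3]
  have key : ∀ (φ : V n →ₗ[ℂ] ℂ) (u v : V n), φ (lam u u) * φ (lam v v) = φ (lam u v) ^ 2 := by
    intro φ u v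
    by_cases hφ : ∀ a b, φ (lam a b) = 0
    · simp [hφ]
    push Not at hφ
    obtain ⟨a, b, hab⟩ := hφ
    by_contra hd
    apply hcon
    refine degen_det hn lam hc φ (u - (φ u / φ (lam a b)) • lam a b)
      (v - (φ v / φ (lam a b)) • lam a b) ?_ ?_ ?_
    · simp [hab]
    · simp [hab]
    · simpa [h3, h3'] using hd
  obtain ⟨a, ha⟩ : ∃ a, lam a a ≠ 0 := by
    by_contra! h
    apply hne
    refine LinearMap.ext fun x => ?_
    refine LinearMap.ext fun y => ?_
    have h1 := h (x + y)
    simp only [map_add, LinearMap.add_apply, hc y x, h x, h y, zero_add, add_zero] at h1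
    rw [← two_smul ℂ, smul_eq_zero] at h1
    simpa using h1
  set z := lam a a with hz
  obtain ⟨ψ, hψ, -⟩ := Submodule.exists_le_ker_of_notMem (p := (⊥ : Submodule ℂ (V n))) (v := z)
    (by simpa using ha)
  let l : V n →ₗ[ℂ] ℂ := (ψ z)⁻¹ • (ψ ∘ₗ lam a)
  have hl : ∀ v, l v = (ψ z)⁻¹ * ψ (lam a v) := fun v => rfl
  have hav : ∀ v, lam a v = l v • z := by
    intro v
    have hm : lam a v ∈ Submodule.span ℂ {z} := by
      by_contra hm
      obtain ⟨φ, hφ, hker⟩ := Submodule.exists_le_ker_of_notMem hm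
      have h0 : φ z = 0 := hker (Submodule.mem_span_singleton_self z)
      have := key φ a v
      rw [← hz, h0, zero_mul] at this
      exact hφ (pow_eq_zero_iff (two_ne_zero) |>.1 this.symm)
    obtain ⟨c, hcz⟩ := Submodule.mem_span_singleton.1 hm
    rw [hl, ← hcz, map_smul, smul_eq_mul, mul_comm c, inv_mul_cancel_left₀ hψ]
  have hsq : ∀ v, lam v v = (l v ^ 2) • z := by
    intro v
    have h1 : ∀ φ : V n →ₗ[ℂ] ℂ, φ z ≠ 0 → φ (lam v v - (l v ^ 2) • z) = 0 := by
      intro φ hφ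
      have := key φ a v
      rw [← hz, hav, map_smul, smul_eq_mul] at this
      rw [map_sub, map_smul, smul_eq_mul]
      apply mul_left_cancel₀ hφ
      linear_combination this
    by_contra hd
    obtain ⟨φ, hφ, -⟩ := Submodule.exists_le_ker_of_notMem (p := (⊥ : Submodule ℂ (V n)))
      (v := lam v v - (l v ^ 2) • z) (by simpa [sub_eq_zero] using hd)
    by_cases h0 : φ z = 0
    · have h2 := h1 (φ + ψ) (by simpa [h0] using hψ)
      rw [LinearMap.add_apply, h1 ψ hψ, add_zero] at h2
      exact hφ h2
    · exact hφ (h1 φ h0)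
  have hmul : ∀ u v, lam u v = (l u * l v) • z := by
    intro u v
    have h1 := hsq (u + v)
    simp only [map_add, LinearMap.add_apply, hc v u, hsq u, hsq v] at h1
    have h2 : (2 : ℂ) • lam u v = (2 : ℂ) • ((l u * l v) • z) := by
      have : (2 : ℂ) • lam u v = (l u + l v) ^ 2 • z - l u ^ 2 • z - l v ^ 2 • z := by
        rw [← h1]; module
      rw [this]; module
    exact smul_right_injective _ (two_ne_zero) h2
  have hla : l a = 1 := by rw [hl, ← hz, inv_mul_cancel₀ hψ]
  have hlz : l z = 0 := by rw [hl, hz, h3, map_zero, mul_zero]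
  have hli : LinearIndependent ℂ ![a, z] := by
    rw [LinearIndependent.pair_iff]
    intro s t hst
    have hs : s = 0 := by
      have := congrArg l hst
      simpa [hla, hlz] using this
    rw [hs, zero_smul, zero_add, smul_eq_zero] at hst
    exact ⟨hs, hst.resolve_right ha⟩
  obtain ⟨g, hg, hgl⟩ := exists_frame_dual _ hli 0 l
    (by intro i; fin_cases i <;> simp [hla, hlz]) (by simp; omega)
  apply hniso
  refine ⟨g, ?_⟩
  refine LinearMap.ext fun x => ?_
  refine LinearMap.ext fun y => ?_
  have h1 : g z = E n 1 := hg 1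
  have hn0 : 0 < n := by omega
  have h2 : ∀ u, l (g.symm u) = u ⟨0, hn0⟩ := by
    intro u
    rw [← hgl, LinearEquiv.apply_symm_apply]; rfl
  rw [act_apply, hmul, map_smul, h1, h2, h2]
  simp only [lam2a, ofTable, LinearMap.mk₂_apply]
  rw [Finset.sum_eq_single ⟨0, hn0⟩, Finset.sum_eq_single ⟨0, hn0⟩]
  · simp
  · intro j _ hj
    have : (j : ℕ) ≠ 0 := fun h => hj (Fin.ext h)
    simp [this]
  · simp
  · intro j _ hj
    have : (j : ℕ) ≠ 0 := fun h => hj (Fin.ext h)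
    simp [this]
  · simp

/-- a nonzero nilpotent Jordan multiplication not isomorphic to
`λ₂ ⊕ 𝔞_{n-2}` degenerates to `J₃`. -/
theorem nilpotent_jordan_degenerates_J3 (n : ℕ) (hn : 3 ≤ n) (lam : Bil n)
    (hJ : JordanMul lam) (hnil : ∃ m : ℕ, Jpow lam m = ⊥) (hne : lam ≠ 0)
    (hniso : ¬ Isom lam (lam2a n)) :
    J3 n ∈ closure (orb lam) := by
  by_cases h3 : Submodule.map₂ lam ⊤ (Submodule.map₂ lam ⊤ ⊤) = ⊥
  · refine case_sq hn lam hJ.1 hne (fun x y z => ?_) hniso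
    rw [← Submodule.mem_bot ℂ, ← h3]
    exact Submodule.apply_mem_map₂ _ trivial (Submodule.apply_mem_map₂ _ trivial trivial)
  · exact case_cube hn lam hJ hnil hne h3
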